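/- Let A and B be simple unital complex C*-algebras, φ : GL(A) → GL(B) a group isomorphism, and θ the induced map on idempotents. Suppose e, f ∈ Ĩ(A) are orthogonal nontrivial idempotents with e + f ≠ 1, with coefficient maps (a_e, b_e) for e and (a_{e+f}, b_{e+f}) for e + f, and c_g = a_g · b_g⁻¹. Then exactly one of the two statements c_e = c_{e+f} and c_e = c_{e+f}⁻¹ holds (as equalities of functions on ℂ∖{0}). -/

import Mathlib

noncomputable section

/-- The symmetry `1 - 2e` associated to an idempotent `e` is a unit (its own inverse). -/
def symUnit {A : Type*} [Ring A] {e : A} (he : IsIdempotentElem e) : Aˣ where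
  val := 1 - 2 * e
  inv := 1 - 2 * e
  val_inv := by
    have h : e * e = e := he
    have expand : (1 - 2 * e) * (1 - 2 * e) = 1 - 4 * e + 4 * (e * e) := by noncomm_ring
    rw [expand, h]; noncomm_ring
  inv_val := by
    have h : e * e = e := he
    have expand : (1 - 2 * e) * (1 - 2 * e) = 1 - 4 * e + 4 * (e * e) := by noncomm_ring
    rw [expand, h]; noncomm_ring

/-- The map `θ_φ` induced on idempotents by a map `φ` between the groups of invertible
elements, determined by `1 - 2 θ_φ(e) = φ(1 - 2e)`, i.e. `θ_φ(e) = (1 - φ(1 - 2e))/2`;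
it is extended by `0` off the set of idempotents. -/
noncomputable def theta {A B : Type*} [Ring A] [Ring B] [Algebra ℂ B]
    (φ : Aˣ → Bˣ) (e : A) : B :=
  letI := Classical.propDecidable (IsIdempotentElem e)
  if h : IsIdempotentElem e then (2 : ℂ)⁻¹ • ((1 : B) - (φ (symUnit h) : B)) else 0

/-- `a` and `b` are coefficient maps for the idempotent `e` (w.r.t. `φ`):
`φ(λe + 1 - e) = a(λ) θ(e) + b(λ) θ(1-e)` for all nonzero `λ`. -/
def IsCoeffMaps {A B : Type*} [Ring A] [Ring B] [Algebra ℂ A] [Algebra ℂ B]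
    (φ : Aˣ → Bˣ) (e : A) (a b : ℂˣ →* ℂˣ) : Prop :=
  ∀ (lam : ℂˣ) (v : Aˣ), (v : A) = (lam : ℂ) • e + 1 - e →
    (φ v : B) = ((a lam : ℂˣ) : ℂ) • theta φ e + ((b lam : ℂˣ) : ℂ) • theta φ (1 - e)

/-- `c(λ) = a(λ) b(λ)⁻¹`, as an element of `ℂˣ`. -/
def cOf (a b : ℂˣ →* ℂˣ) (lam : ℂˣ) : ℂˣ := a lam * (b lam)⁻¹

variable {A B : Type*}
  [NormedRing A] [StarRing A] [CStarRing A] [CompleteSpace A]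
  [NormedAlgebra ℂ A] [StarModule ℂ A]
  [NormedRing B] [StarRing B] [CStarRing B] [CompleteSpace B]
  [NormedAlgebra ℂ B] [StarModule ℂ B]

section CoefficientMaps

variable {R S : Type*} [Ring R] [Ring S]

theorem symUnit_val {e : R} (he : IsIdempotentElem e) : (symUnit he : R) = 1 - 2 * e := rfl

theorem exists_mul_mul_ne_zero [IsSimpleRing R] {e g : R} (he : e ≠ 0) (hg : g ≠ 0) :
    ∃ z, e * z * g ≠ 0 := by
  by_contra! h
  let I : TwoSidedIdeal R := .mk' {x | ∀ z, e * z * x = 0} (by simp)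
    (fun hx hy z => by rw [mul_add, hx z, hy z, add_zero])
    (fun hx z => by rw [mul_neg, hx z, neg_zero])
    (fun {x y} hy z => by simpa [mul_assoc] using hy (z * x))
    (fun {x y} hx z => by rw [← mul_assoc, hx z, zero_mul])
  have hI : ∀ {x}, x ∈ I ↔ ∀ z, e * z * x = 0 := TwoSidedIdeal.mem_mk' _ _ _ _ _ _ _
  have h1 : (1 : R) ∈ I := IsSimpleRing.one_mem_of_ne_zero_mem I hg (hI.2 h)
  exact he (by simpa using hI.1 h1 1)

theorem eq_one_or_eq_neg_one_of_mem_center [IsSimpleRing R] {z : R} (hz : z ∈ Subring.center R)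
    (h : z * z = 1) : z = 1 ∨ z = -1 := by
  let _ := (IsSimpleRing.isField_center R).toField
  have h' : (⟨z, hz⟩ : Subring.center R) * ⟨z, hz⟩ = 1 := Subtype.ext h
  exact (mul_self_eq_one_iff.1 h').imp (congrArg Subtype.val) (congrArg Subtype.val)

theorem mem_center_of_commute_units {D : Type*} [NormedRing D] [CompleteSpace D]
    [NormedAlgebra ℂ D] {z : D} (h : ∀ u : Dˣ, (u : D) * z = z * u) :
    z ∈ Subring.center D := by
  rw [Subring.mem_center_iff]
  intro b
  have hk : ‖b‖ * ‖(1 : D)‖ < ‖((‖b‖ * ‖(1 : D)‖ + 1 : ℝ) : ℂ)‖ := by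
    rw [Complex.norm_real, Real.norm_of_nonneg (by positivity)]
    linarith
  obtain ⟨u, hu⟩ := spectrum.mem_resolventSet_of_norm_lt_mul hk
  have hc := h u
  rw [hu, sub_mul, mul_sub, Algebra.commutes] at hc
  exact sub_right_injective hc

theorem MulEquiv.map_neg_one_units {D : Type*} [NormedRing D] [CompleteSpace D]
    [NormedAlgebra ℂ D] [IsSimpleRing D] (φ : Rˣ ≃* Dˣ) (h2 : (-1 : R) ≠ 1) : φ (-1) = -1 := by
  have hcen : ((φ (-1) : Dˣ) : D) ∈ Subring.center D := by
    refine mem_center_of_commute_units fun u => ?_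
    obtain ⟨v, rfl⟩ := φ.surjective u
    rw [← Units.val_mul, ← Units.val_mul, ← map_mul, ← map_mul, mul_neg_one, neg_one_mul]
  have hsq : ((φ (-1) : Dˣ) : D) * (φ (-1) : Dˣ) = 1 := by
    rw [← Units.val_mul, ← map_mul]; simp
  rcases eq_one_or_eq_neg_one_of_mem_center hcen hsq with h | h
  · have : φ (-1) = φ 1 := by rw [map_one]; exact Units.ext h
    exact absurd (congrArg Units.val (φ.injective this)) (by simpa using h2)
  · exact Units.ext (by simpa using h)

variable [Algebra ℂ S]

theorem two_mul_theta (φ : Rˣ → Sˣ) {e : R} (he : IsIdempotentElem e) :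
    2 * theta φ e = 1 - (φ (symUnit he) : S) := by
  rw [theta, dif_pos he, two_mul, ← add_smul]
  norm_num

theorem eq_of_two_mul_eq {x y : S} (h : 2 * x = 2 * y) : x = y := by
  have h' := congrArg ((2 : ℂ)⁻¹ • ·) h
  simp only [two_mul, ← two_smul ℂ, smul_smul] at h'
  simpa using h'

theorem theta_one_sub {φ : Rˣ ≃* Sˣ} (hφ : φ (-1) = -1) {e : R} (he : IsIdempotentElem e) :
    theta φ (1 - e) = 1 - theta φ e := by
  apply eq_of_two_mul_eq
  have h : symUnit he.one_sub = -1 * symUnit he := by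
    ext
    simp only [symUnit_val, Units.val_mul, Units.val_neg, Units.val_one]
    noncomm_ring
  rw [mul_sub, two_mul_theta _ he.one_sub, two_mul_theta _ he, h, map_mul, hφ]
  simp only [Units.val_mul, Units.val_neg, Units.val_one]
  noncomm_ring

theorem isIdempotentElem_theta (φ : Rˣ ≃* Sˣ) {e : R} (he : IsIdempotentElem e) :
    IsIdempotentElem (theta φ e) := by
  have h : symUnit he * symUnit he = 1 := Units.ext (symUnit he).mul_inv
  have h' : (φ (symUnit he) : S) * φ (symUnit he) = 1 := by
    rw [← Units.val_mul, ← map_mul, h, map_one, Units.val_one]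
  have hs : (φ (symUnit he) : S) = 1 - 2 * theta φ e := by
    rw [two_mul_theta _ he]; abel
  rw [hs] at h'
  apply eq_of_two_mul_eq
  apply eq_of_two_mul_eq
  have : (1 - 2 * theta φ e) * (1 - 2 * theta φ e) =
      1 - 2 * (2 * theta φ e) + 2 * (2 * (theta φ e * theta φ e)) := by noncomm_ring
  rw [this, sub_add_eq_add_sub, add_sub_assoc, add_eq_left, sub_eq_zero] at h'
  exact h'

theorem coe_map_symUnit (φ : Rˣ → Sˣ) {e : R} (he : IsIdempotentElem e) :
    (φ (symUnit he) : S) = 1 - 2 * theta φ e := by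
  rw [two_mul_theta _ he]; abel

theorem commute_one_sub_two_mul_iff {x y : S} : Commute (1 - 2 * x) y ↔ Commute x y := by
  refine ⟨fun h => eq_of_two_mul_eq ?_,
    fun h => (Commute.one_left y).sub_left ((Commute.ofNat_left 2 y).mul_left h)⟩
  have h' := h.eq
  rwa [sub_mul, mul_sub, one_mul, mul_one, sub_right_inj, ← mul_assoc,
    ← (Commute.ofNat_left 2 y).eq, mul_assoc, mul_assoc] at h'

theorem commute_theta_iff [Algebra ℂ R] (φ : Rˣ ≃* Sˣ) {e : R} (he : IsIdempotentElem e)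
    (u : Rˣ) : Commute (theta φ e) (φ u) ↔ Commute e (u : R) := by
  rw [← commute_one_sub_two_mul_iff, ← coe_map_symUnit φ he, ← commute_one_sub_two_mul_iff (x := e),
    ← symUnit_val he, Commute.units_val_iff, Commute.units_val_iff]
  exact ⟨fun h => by simpa using h.map φ.symm, fun h => h.map φ⟩

theorem commute_theta_theta [Algebra ℂ R] (φ : Rˣ ≃* Sˣ) {e f : R} (he : IsIdempotentElem e)
    (hf : IsIdempotentElem f) (h : Commute e f) : Commute (theta φ e) (theta φ f) := by
  have h1 : Commute e (symUnit hf : R) :=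
    (commute_one_sub_two_mul_iff.2 h.symm).symm
  rw [← commute_theta_iff φ he, coe_map_symUnit] at h1
  exact (commute_one_sub_two_mul_iff.1 h1.symm).symm

/-- The unit `λe + 1 - e`, with inverse `λ⁻¹e + 1 - e`. -/
def scalarUnit [Algebra ℂ R] {e : R} (he : IsIdempotentElem e) (l : ℂˣ) : Rˣ where
  val := (l : ℂ) • e + 1 - e
  inv := ((l⁻¹ : ℂˣ) : ℂ) • e + 1 - e
  val_inv := by
    have h : ((l : ℂ) • e) * (((l⁻¹ : ℂˣ) : ℂ) • e) = e := by
      rw [smul_mul_smul_comm, he.eq, Units.mul_inv, one_smul]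
    simp only [sub_mul, add_mul, mul_sub, mul_add, h]
    simp only [smul_mul_assoc, mul_smul_comm, he.eq, one_mul, mul_one]
    abel
  inv_val := by
    have h : (((l⁻¹ : ℂˣ) : ℂ) • e) * ((l : ℂ) • e) = e := by
      rw [smul_mul_smul_comm, he.eq, Units.inv_mul, one_smul]
    simp only [sub_mul, add_mul, mul_sub, mul_add, h]
    simp only [smul_mul_assoc, mul_smul_comm, he.eq, one_mul, mul_one]
    abel

theorem scalarUnit_val [Algebra ℂ R] {e : R} (he : IsIdempotentElem e) (l : ℂˣ) :
    (scalarUnit he l : R) = (l : ℂ) • e + 1 - e := rfl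

theorem scalarUnit_inv [Algebra ℂ R] {e : R} (he : IsIdempotentElem e) (l : ℂˣ) :
    scalarUnit he l⁻¹ = (scalarUnit he l)⁻¹ := Units.ext rfl

theorem scalarUnit_neg_one [Algebra ℂ R] {e : R} (he : IsIdempotentElem e) :
    scalarUnit he (-1) = symUnit he := by
  ext
  rw [scalarUnit_val, symUnit_val, Units.val_neg, Units.val_one, neg_one_smul, two_mul]
  abel

/-- The unit `1 + y` for an element `y` of square zero. -/
def unipotentUnit {y : R} (hy : y * y = 0) : Rˣ where
  val := 1 + y
  inv := 1 - y
  val_inv := by rw [add_mul, mul_sub, mul_sub, hy]; simp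
  inv_val := by rw [sub_mul, mul_add, mul_add, hy]; simp

theorem unipotentUnit_val {y : R} (hy : y * y = 0) : (unipotentUnit hy : R) = 1 + y := rfl

theorem scalarUnit_conj_unipotentUnit [Algebra ℂ R] {e y : R} (he : IsIdempotentElem e)
    (hy : y * y = 0) (hey : e * y = y) (hye : y * e = 0) (l : ℂˣ) :
    ((scalarUnit he l * unipotentUnit hy * (scalarUnit he l)⁻¹ : Rˣ) : R) = 1 + (l : ℂ) • y := by
  rw [Units.val_mul, Units.mul_inv_eq_iff_eq_mul, Units.val_mul, scalarUnit_val,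
    unipotentUnit_val]
  simp only [mul_add, add_mul, sub_mul, mul_sub, mul_one, one_mul, smul_mul_assoc, mul_smul_comm,
    hey, hye, smul_zero]
  abel

theorem IsCoeffMaps.coe_map_scalarUnit [Algebra ℂ R] {φ : Rˣ ≃* Sˣ} (hφ : φ (-1) = -1) {e : R}
    (he : IsIdempotentElem e) {a b : ℂˣ →* ℂˣ} (h : IsCoeffMaps φ e a b) (l : ℂˣ) :
    (φ (scalarUnit he l) : S) = (a l : ℂ) • theta φ e + (b l : ℂ) • (1 - theta φ e) := by
  rw [h l _ (scalarUnit_val he l), theta_one_sub hφ he]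

theorem IsCoeffMaps.exists_cOf_ne_one [Algebra ℂ R] {φ : Rˣ ≃* Sˣ} (hφ : φ (-1) = -1) {e : R}
    (he : IsIdempotentElem e) (he0 : e ≠ 0) (he1 : e ≠ 1) {a b : ℂˣ →* ℂˣ}
    (h : IsCoeffMaps φ e a b) : ∃ l, cOf a b l ≠ 1 := by
  by_contra! hc
  have hab : a (-1) = b (-1) := mul_inv_eq_one.1 (hc (-1))
  have hs : (φ (symUnit he) : S) = (a (-1) : ℂ) • 1 := by
    rw [← scalarUnit_neg_one, h.coe_map_scalarUnit hφ, ← hab, ← smul_add, add_sub_cancel]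
  have ha : (a (-1) : ℂ) * a (-1) = 1 := by
    rw [← Units.val_mul, ← map_mul]; simp
  rcases mul_self_eq_one_iff.1 ha with ha | ha
  · have h1 : φ (symUnit he) = φ 1 := by
      ext; rw [hs, ha, one_smul, map_one, Units.val_one]
    have h2 := congrArg Units.val (φ.injective h1)
    rw [symUnit_val, Units.val_one, sub_eq_self] at h2
    exact he0 (eq_of_two_mul_eq (by rw [h2, mul_zero]))
  · have h1 : φ (symUnit he) = φ (-1) := by
      ext; rw [hs, ha, neg_one_smul, hφ, Units.val_neg, Units.val_one]
    have h2 := congrArg Units.val (φ.injective h1)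
    rw [symUnit_val, Units.val_neg, Units.val_one, sub_eq_iff_eq_add, eq_neg_add_iff_add_eq] at h2
    exact he1 (eq_of_two_mul_eq (by rw [← h2, mul_one, one_add_one_eq_two]))

/-- Conjugation of `U` by `a(λ)p + b(λ)(1-p)` agrees with conjugation by
`a'(λ)q + b'(λ)(1-q)` for all `λ`. -/
def ConjAgree (U p q : S) (a b a' b' : ℂˣ →* ℂˣ) : Prop :=
  ∀ l : ℂˣ,
    ((a l : ℂ) • p + (b l : ℂ) • (1 - p)) * U * ((a l⁻¹ : ℂ) • p + (b l⁻¹ : ℂ) • (1 - p)) =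
    ((a' l : ℂ) • q + (b' l : ℂ) • (1 - q)) * U * ((a' l⁻¹ : ℂ) • q + (b' l⁻¹ : ℂ) • (1 - q))

namespace ConjAgree

variable {U p q : S} {a b a' b' : ℂˣ →* ℂˣ}

theorem swap_left (h : ConjAgree U p q a b a' b') : ConjAgree U (1 - p) q b a a' b' := fun l => by
  rw [sub_sub_cancel, add_comm, add_comm (_ • (1 - p)), h l]

theorem swap_right (h : ConjAgree U p q a b a' b') : ConjAgree U p (1 - q) a b b' a' := fun l => by
  rw [sub_sub_cancel, h l, add_comm, add_comm ((a' l⁻¹ : ℂ) • q)]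

theorem smul_corner_eq (h : ConjAgree U p q a b a' b') {P P' : S} (hp : P * p = P)
    (hq : P * q = P) (hp' : p * P' = 0) (l : ℂˣ) :
    ((cOf a b l : ℂˣ) : ℂ) • (P * U * P') =
      (a' l : ℂ) • (P * U * ((a' l⁻¹ : ℂ) • (q * P') + (b' l⁻¹ : ℂ) • (P' - q * P'))) := by
  have h1 := congrArg (P * · * P') (h l)
  have hX : P * ((a l : ℂ) • p + (b l : ℂ) • (1 - p)) = (a l : ℂ) • P := by
    rw [mul_add, mul_smul_comm, mul_smul_comm, mul_sub, hp, mul_one, sub_self, smul_zero, add_zero]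
  have hY : P * ((a' l : ℂ) • q + (b' l : ℂ) • (1 - q)) = (a' l : ℂ) • P := by
    rw [mul_add, mul_smul_comm, mul_smul_comm, mul_sub, hq, mul_one, sub_self, smul_zero, add_zero]
  have hX' : ((a l⁻¹ : ℂ) • p + (b l⁻¹ : ℂ) • (1 - p)) * P' = (b l⁻¹ : ℂ) • P' := by
    rw [add_mul, smul_mul_assoc, smul_mul_assoc, sub_mul, hp', one_mul, sub_zero, smul_zero,
      zero_add]
  have hY' : ((a' l⁻¹ : ℂ) • q + (b' l⁻¹ : ℂ) • (1 - q)) * P' =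
      (a' l⁻¹ : ℂ) • (q * P') + (b' l⁻¹ : ℂ) • (P' - q * P') := by
    rw [add_mul, smul_mul_assoc, smul_mul_assoc, sub_mul, one_mul]
  simp only [mul_assoc, hX', hY'] at h1
  rw [← mul_assoc, ← mul_assoc, hX, ← mul_assoc P, hY, smul_mul_assoc, smul_mul_assoc,
    smul_mul_assoc, mul_smul_comm, smul_smul, ← mul_assoc, map_inv] at h1
  rw [cOf, Units.val_mul]
  exact h1

theorem opposite_corner_eq_zero (h : ConjAgree U p q a b a' b') (hp : IsIdempotentElem p)
    (hq : IsIdempotentElem q) (hpq : Commute p q)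
    (hne : ¬ ∀ l, cOf a b l = cOf a' b' l) : p * q * U * ((1 - p) * (1 - q)) = 0 := by
  contrapose! hne
  intro l
  have hp' : p * ((1 - p) * (1 - q)) = 0 := by rw [← mul_assoc, hp.mul_one_sub_self, zero_mul]
  have hq' : q * ((1 - p) * (1 - q)) = 0 := by
    rw [← mul_assoc, ((Commute.one_right q).sub_right hpq.symm).eq, mul_assoc,
      hq.mul_one_sub_self, mul_zero]
  have h1 := h.smul_corner_eq (P := p * q) (by rw [mul_assoc, ← hpq.eq, ← mul_assoc, hp.eq])
    (by rw [mul_assoc, hq.eq]) hp' l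
  rw [hq', smul_zero, zero_add, sub_zero, mul_smul_comm, smul_smul, ← Units.val_mul,
    map_inv] at h1
  exact Units.ext (smul_left_injective ℂ hne h1)

theorem same_corner_eq_zero (h : ConjAgree U p q a b a' b') (hp : IsIdempotentElem p)
    (hq : IsIdempotentElem q) (hpq : Commute p q)
    (hne : ¬ ∀ l, cOf a b l = 1) : p * q * U * ((1 - p) * q) = 0 := by
  contrapose! hne
  intro l
  have hp' : p * ((1 - p) * q) = 0 := by rw [← mul_assoc, hp.mul_one_sub_self, zero_mul]
  have hq' : q * ((1 - p) * q) = (1 - p) * q := by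
    rw [← mul_assoc, ((Commute.one_right q).sub_right hpq.symm).eq, mul_assoc, hq.eq]
  have h1 := h.smul_corner_eq (P := p * q) (by rw [mul_assoc, ← hpq.eq, ← mul_assoc, hp.eq])
    (by rw [mul_assoc, hq.eq]) hp' l
  rw [hq', sub_self, smul_zero, add_zero, mul_smul_comm, smul_smul, ← Units.val_mul, ← map_mul,
    mul_inv_cancel, map_one] at h1
  exact Units.ext (smul_left_injective ℂ hne h1)

end ConjAgree

theorem cOf_eq_or_eq_inv_of_conjAgree {p q U : S} (hp : IsIdempotentElem p)
    (hq : IsIdempotentElem q) (hpq : Commute p q) {a b a' b' : ℂˣ →* ℂˣ}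
    (h : ConjAgree U p q a b a' b') (hU : ¬ Commute p U) (hc : ∃ l, cOf a b l ≠ 1) :
    (∀ l, cOf a b l = cOf a' b' l) ∨ ∀ l, cOf a b l = (cOf a' b' l)⁻¹ := by
  have hswap : ∀ (x y : ℂˣ →* ℂˣ) l, cOf y x l = (cOf x y l)⁻¹ := fun x y l => by
    rw [cOf, cOf, mul_inv, inv_inv, mul_comm]
  have hab : ¬ ∀ l, cOf a b l = 1 := by simpa using hc
  have hba : ¬ ∀ l, cOf b a l = 1 := by simpa [hswap a b] using hc
  have hpq₁ : Commute (1 - p) q := (Commute.one_left q).sub_left hpq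
  have hpq₂ : Commute p (1 - q) := (Commute.one_right p).sub_right hpq
  have hpq₃ : Commute (1 - p) (1 - q) := (Commute.one_right _).sub_right hpq₁
  by_contra hcon
  obtain ⟨h_eq, h_inv⟩ := not_or.1 hcon
  apply hU
  have h1 : p * U * (1 - p) = 0 := by
    have e : p * U * (1 - p) = p * q * U * ((1 - p) * (1 - q)) + p * q * U * ((1 - p) * q) +
      (p * (1 - q) * U * ((1 - p) * (1 - (1 - q))) +
        p * (1 - q) * U * ((1 - p) * (1 - q))) := by noncomm_ring
    rw [e, h.opposite_corner_eq_zero hp hq hpq h_eq, h.same_corner_eq_zero hp hq hpq hab,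
      h.swap_right.opposite_corner_eq_zero hp hq.one_sub hpq₂ (by simpa only [hswap a'] using h_inv),
      h.swap_right.same_corner_eq_zero hp hq.one_sub hpq₂ hab, add_zero, add_zero]
  have h2 : (1 - p) * U * p = 0 := by
    have e : (1 - p) * U * p =
      (1 - p) * q * U * ((1 - (1 - p)) * (1 - q)) + (1 - p) * q * U * ((1 - (1 - p)) * q) +
      ((1 - p) * (1 - q) * U * ((1 - (1 - p)) * (1 - (1 - q))) +
        (1 - p) * (1 - q) * U * ((1 - (1 - p)) * (1 - q))) := by noncomm_ring
    rw [e, h.swap_left.opposite_corner_eq_zero hp.one_sub hq hpq₁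
        (by simpa only [hswap a, inv_eq_iff_eq_inv] using h_inv),
      h.swap_left.same_corner_eq_zero hp.one_sub hq hpq₁ hba,
      h.swap_left.swap_right.opposite_corner_eq_zero hp.one_sub hq.one_sub hpq₃
        (by simpa only [hswap a, hswap a', inv_inj] using h_eq),
      h.swap_left.swap_right.same_corner_eq_zero hp.one_sub hq.one_sub hpq₃ hba,
      add_zero, add_zero]
  rw [mul_sub, mul_one, sub_eq_zero] at h1
  rw [sub_mul, sub_mul, one_mul, sub_eq_zero] at h2
  rw [commute_iff_eq, h1, h2]

end CoefficientMaps

theorem statement10 [IsSimpleRing A] [IsSimpleRing B] (φ : Aˣ ≃* Bˣ)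
    (e f : A) (he : IsIdempotentElem e) (he0 : e ≠ 0) (he1 : e ≠ 1)
    (hf : IsIdempotentElem f) (hf0 : f ≠ 0) (hf1 : f ≠ 1)
    (hef : e * f = 0) (hfe : f * e = 0) (hone : e + f ≠ 1)
    (ae be aef bef : ℂˣ →* ℂˣ)
    (hce : IsCoeffMaps (⇑φ) e ae be) (hcef : IsCoeffMaps (⇑φ) (e + f) aef bef) :
    Xor' (∀ lam : ℂˣ, cOf ae be lam = cOf aef bef lam)
      (∀ lam : ℂˣ, cOf ae be lam = (cOf aef bef lam)⁻¹) := by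
  have hne : (-1 : A) ≠ 1 := by
    intro h
    have h1 : (2 : A) * 1 = 2 * 0 := by
      rw [mul_one, mul_zero, ← one_add_one_eq_two]
      nth_rw 1 [← h]
      exact neg_add_cancel 1
    exact one_ne_zero (eq_of_two_mul_eq h1)
  have hφ : φ (-1) = -1 := MulEquiv.map_neg_one_units φ hne
  have hs : IsIdempotentElem (e + f) := by
    rw [IsIdempotentElem, add_mul, mul_add, mul_add, he.eq, hf.eq, hef, hfe, add_zero, zero_add]
  have hce1 := hce.exists_cOf_ne_one hφ he he0 he1
  have hor : (∀ l, cOf ae be l = cOf aef bef l) ∨ ∀ l, cOf ae be l = (cOf aef bef l)⁻¹ := by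
    obtain ⟨z, hz⟩ := exists_mul_mul_ne_zero he0 (sub_ne_zero.2 hone.symm)
    set y := e * z * (1 - (e + f)) with hy
    have hey : e * y = y := by rw [hy, ← mul_assoc, ← mul_assoc, he.eq]
    have hye : y * e = 0 := by
      rw [hy, mul_assoc, sub_mul, add_mul, he.eq, hfe, one_mul, add_zero, sub_self, mul_zero]
    have hfy : f * y = 0 := by rw [hy, ← mul_assoc, ← mul_assoc, hfe, zero_mul, zero_mul]
    have hyf : y * f = 0 := by
      rw [hy, mul_assoc, sub_mul, add_mul, hf.eq, hef, one_mul, zero_add, sub_self, mul_zero]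
    have hyy : y * y = 0 := by
      nth_rw 2 [← hey]
      rw [← mul_assoc, hye, zero_mul]
    refine cOf_eq_or_eq_inv_of_conjAgree (U := (φ (unipotentUnit hyy) : B))
      (isIdempotentElem_theta φ he) (isIdempotentElem_theta φ hs)
      (commute_theta_theta φ he hs ?_) (fun l => ?_) ?_ hce1
    · rw [commute_iff_eq, mul_add, add_mul, hef, hfe]
    · rw [← hce.coe_map_scalarUnit hφ he, ← hce.coe_map_scalarUnit hφ he,
        ← hcef.coe_map_scalarUnit hφ hs, ← hcef.coe_map_scalarUnit hφ hs]
      simp only [← Units.val_mul, ← map_mul, scalarUnit_inv]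
      congr 2
      ext
      rw [scalarUnit_conj_unipotentUnit he hyy hey hye, scalarUnit_conj_unipotentUnit hs hyy
        (by rw [add_mul, hey, hfy, add_zero]) (by rw [mul_add, hye, hyf, add_zero])]
    · rw [commute_theta_iff φ he, unipotentUnit_val, commute_iff_eq, mul_add, add_mul, hey, hye,
        mul_one, one_mul, add_right_inj]
      exact hz
  have hnot : ¬ ((∀ l, cOf ae be l = cOf aef bef l) ∧ ∀ l, cOf ae be l = (cOf aef bef l)⁻¹) := by
    rintro ⟨h1, h2⟩
    obtain ⟨l, hl⟩ := hce1
    obtain ⟨m, hm⟩ := IsAlgClosed.exists_pow_nat_eq (l : ℂ) two_pos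
    have hm0 : m ≠ 0 := by
      rintro rfl
      exact l.ne_zero (by simpa using hm.symm)
    have hml : Units.mk0 m hm0 * Units.mk0 m hm0 = l := by
      ext
      rw [← hm, sq, Units.val_mul, Units.val_mk0]
    have h3 : cOf ae be (Units.mk0 m hm0) * cOf ae be (Units.mk0 m hm0) = 1 := by
      nth_rw 1 [h1]
      rw [h2, mul_inv_cancel]
    apply hl
    rw [← h3, ← hml, cOf, cOf, map_mul, map_mul, mul_inv, mul_mul_mul_comm]
  rcases hor with h | h
  · exact Or.inl ⟨h, fun h' => hnot ⟨h, h'⟩⟩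
  · exact Or.inr ⟨h, fun h' => hnot ⟨h', h⟩⟩

end
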